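/- The set of translations of an affine plane forms a subgroup of the group of dilations under composition: the identity map is a translation, the composition of any two translations is a translation, and the inverse of any translation is a translation. -/

import Mathlib

/-- An affine plane: a type `P` of points together with a set of subsets of `P`
(the lines) satisfying the three axioms of affine planes. -/
structure AffinePlane (P : Type*) where
  lines : Set (Set P)
  /-- A1: any two distinct points lie on exactly one line. -/
  a1 : ∀ A B : P, A ≠ B → ∃! ℓ : Set P, ℓ ∈ lines ∧ A ∈ ℓ ∧ B ∈ ℓ
  /-- A2: for a point `A` not on a line `ℓ` there is exactly one line through `A`
  disjoint from `ℓ`. -/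
  a2 : ∀ (A : P) (ℓ : Set P), ℓ ∈ lines → A ∉ ℓ →
    ∃! m : Set P, m ∈ lines ∧ A ∈ m ∧ m ∩ ℓ = ∅
  /-- A3: there are three points not all on one line. -/
  a3 : ∃ A B C : P, ∀ ℓ ∈ lines, ¬(A ∈ ℓ ∧ B ∈ ℓ ∧ C ∈ ℓ)

namespace AffinePlane

variable {P : Type*}

/-- Two lines are parallel if they are equal or disjoint. -/
def Parallel (π : AffinePlane P) (ℓ m : Set P) : Prop :=
  ℓ = m ∨ ℓ ∩ m = ∅

/-- A collineation is a bijection of the points mapping lines to lines. -/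
def IsCollineation (π : AffinePlane P) (f : P ≃ P) : Prop :=
  ∀ ℓ ∈ π.lines, f '' ℓ ∈ π.lines

/-- A dilation is a collineation `f` such that for all distinct points `A`, `B`,
the line through `f A` and `f B` is parallel to the line through `A` and `B`. -/
def IsDilation (π : AffinePlane P) (f : P ≃ P) : Prop :=
  IsCollineation π f ∧
  ∀ A B : P, A ≠ B → ∀ ℓ m : Set P,
    (ℓ ∈ π.lines ∧ f A ∈ ℓ ∧ f B ∈ ℓ) →
    (m ∈ π.lines ∧ A ∈ m ∧ B ∈ m) →
    Parallel π ℓ m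

/-- A translation is a dilation which is the identity or has no fixed point. -/
def IsTranslation (π : AffinePlane P) (f : P ≃ P) : Prop :=
  IsDilation π f ∧ (f = Equiv.refl P ∨ ∀ A : P, f A ≠ A)

theorem Parallel.symm {π : AffinePlane P} {ℓ m : Set P} (h : Parallel π ℓ m) :
    Parallel π m ℓ :=
  h.imp Eq.symm fun h => by rwa [Set.inter_comm]

theorem Parallel.eq_of_mem {π : AffinePlane P} {ℓ m : Set P} {A : P}
    (h : Parallel π ℓ m) (hl : A ∈ ℓ) (hm : A ∈ m) : ℓ = m :=
  h.resolve_right (Set.Nonempty.ne_empty ⟨A, hl, hm⟩)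

theorem Parallel.trans {π : AffinePlane P} {ℓ m n : Set P} (hℓ : ℓ ∈ π.lines)
    (hm : m ∈ π.lines) (hn : n ∈ π.lines) (h₁ : Parallel π ℓ m)
    (h₂ : Parallel π m n) : Parallel π ℓ n := by
  refine or_iff_not_imp_right.2 fun h => ?_
  obtain ⟨A, hAℓ, hAn⟩ := Set.nonempty_iff_ne_empty.2 h
  by_cases hA : A ∈ m
  · exact (h₁.eq_of_mem hAℓ hA).trans (h₂.eq_of_mem hA hAn)
  · have h₁' : ℓ ∩ m = ∅ := h₁.resolve_left fun e => hA (e ▸ hAℓ)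
    have h₂' : n ∩ m = ∅ := h₂.symm.resolve_left fun e => hA (e ▸ hAn)
    exact (π.a2 A m hm hA).unique ⟨hℓ, hAℓ, h₁'⟩ ⟨hn, hAn, h₂'⟩

theorem exists_notMem (π : AffinePlane P) {ℓ : Set P} (hℓ : ℓ ∈ π.lines) :
    ∃ A, A ∉ ℓ := by
  obtain ⟨A, B, C, h⟩ := π.a3
  by_contra! hc
  exact h ℓ hℓ ⟨hc A, hc B, hc C⟩

theorem nonempty_of_mem_lines (π : AffinePlane P) {ℓ : Set P} (hℓ : ℓ ∈ π.lines) :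
    ℓ.Nonempty := by
  by_contra hne
  obtain rfl := Set.not_nonempty_iff_eq_empty.1 hne
  obtain ⟨A, -⟩ := π.exists_notMem hℓ
  obtain ⟨m, ⟨hm, hAm, -⟩, huniq⟩ := π.a2 A ∅ hℓ (Set.notMem_empty A)
  obtain ⟨B, hB⟩ := π.exists_notMem hm
  obtain ⟨n, ⟨hn, hAn, hBn⟩, -⟩ := π.a1 A B fun e => hB (e ▸ hAm)
  exact hB (huniq n ⟨hn, hAn, Set.inter_empty n⟩ ▸ hBn)

theorem nontrivial_of_mem_lines (π : AffinePlane P) {ℓ : Set P} (hℓ : ℓ ∈ π.lines) :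
    ℓ.Nontrivial := by
  obtain ⟨A, hA⟩ := π.nonempty_of_mem_lines hℓ
  by_contra hnt
  have hsing : ∀ X ∈ ℓ, X = A := fun X hX => Set.not_nontrivial_iff.1 hnt hX hA
  obtain ⟨B, hB⟩ := π.exists_notMem hℓ
  have hAB : A ≠ B := fun e => hB (e ▸ hA)
  obtain ⟨n, ⟨hn, hAn, hBn⟩, hnu⟩ := π.a1 A B hAB
  obtain ⟨C, hC⟩ := π.exists_notMem hn
  obtain ⟨k, ⟨hk, hBk, hCk⟩, -⟩ := π.a1 B C fun e => hC (e ▸ hBn)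
  obtain ⟨q, ⟨hq, hAq, hCq⟩, -⟩ := π.a1 A C fun e => hC (e ▸ hAn)
  have hAk : A ∉ k := fun h => hC (hnu k ⟨hk, h, hBk⟩ ▸ hCk)
  have hBq : B ∉ q := fun h => hC (hnu q ⟨hq, hAq, h⟩ ▸ hCq)
  obtain ⟨p, ⟨hp, hBp, hpq⟩, -⟩ := π.a2 B q hq hBq
  have hAp : A ∉ p := fun h => Set.eq_empty_iff_forall_notMem.1 hpq A ⟨h, hAq⟩
  have disj : ∀ r : Set P, A ∉ r → r ∩ ℓ = ∅ := fun r hr =>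
    Set.eq_empty_iff_forall_notMem.2 fun X hX => hr (hsing X hX.2 ▸ hX.1)
  have hpk : p = k := (π.a2 B ℓ hℓ hB).unique ⟨hp, hBp, disj p hAp⟩ ⟨hk, hBk, disj k hAk⟩
  exact Set.eq_empty_iff_forall_notMem.1 hpq C ⟨hpk ▸ hCk, hCq⟩

theorem IsCollineation.symm {π : AffinePlane P} {f : P ≃ P} (hf : IsCollineation π f) :
    IsCollineation π f.symm := by
  intro ℓ hℓ
  obtain ⟨A, hA, B, hB, hAB⟩ := π.nontrivial_of_mem_lines hℓ
  obtain ⟨m, ⟨hm, hAm, hBm⟩, -⟩ := π.a1 (f.symm A) (f.symm B) (f.symm.injective.ne hAB)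
  have h : ℓ = f '' m := (π.a1 A B hAB).unique ⟨hℓ, hA, hB⟩
    ⟨hf m hm, ⟨_, hAm, f.apply_symm_apply A⟩, ⟨_, hBm, f.apply_symm_apply B⟩⟩
  rw [h, Equiv.symm_image_image]
  exact hm

theorem IsCollineation.trans {π : AffinePlane P} {f g : P ≃ P} (hg : IsCollineation π g)
    (hf : IsCollineation π f) : IsCollineation π (g.trans f) := by
  intro ℓ hℓ
  rw [Equiv.coe_trans, Set.image_comp]
  exact hf _ (hg ℓ hℓ)

theorem isDilation_refl (π : AffinePlane P) : IsDilation π (Equiv.refl P) := by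
  refine ⟨fun ℓ hℓ => by simpa using hℓ, fun A B hAB ℓ m hℓ hm => Or.inl ?_⟩
  exact (π.a1 A B hAB).unique hℓ hm

theorem IsDilation.symm {π : AffinePlane P} {f : P ≃ P} (hf : IsDilation π f) :
    IsDilation π f.symm := by
  refine ⟨hf.1.symm, fun A B hAB ℓ m hℓ hm => ?_⟩
  exact (hf.2 _ _ (f.symm.injective.ne hAB) m ℓ (by simpa using hm) hℓ).symm

theorem IsDilation.trans {π : AffinePlane P} {f g : P ≃ P} (hg : IsDilation π g)
    (hf : IsDilation π f) : IsDilation π (g.trans f) := by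
  refine ⟨hg.1.trans hf.1, fun A B hAB ℓ m hℓ hm => ?_⟩
  have hgAB := g.injective.ne hAB
  obtain ⟨k, hk, -⟩ := π.a1 (g A) (g B) hgAB
  exact (hf.2 _ _ hgAB ℓ k hℓ hk).trans hℓ.1 hk.1 hm.1 (hg.2 A B hAB k m hk hm)

/-- A dilation maps a line containing a point and its image into itself. -/
theorem IsDilation.apply_mem {π : AffinePlane P} {f : P ≃ P} (hf : IsDilation π f)
    {ℓ : Set P} (hℓ : ℓ ∈ π.lines) {X Y : P} (hX : X ∈ ℓ) (hfX : f X ∈ ℓ)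
    (hY : Y ∈ ℓ) : f Y ∈ ℓ := by
  by_cases hXY : X = Y
  · exact hXY ▸ hfX
  obtain ⟨m, hm, -⟩ := π.a1 (f X) (f Y) (f.injective.ne hXY)
  rw [← (hf.2 X Y hXY m ℓ hm ⟨hℓ, hX, hY⟩).eq_of_mem hm.2.1 hfX]
  exact hm.2.2

/-- A line joining a point to its distinct image is disjoint from every invariant line of a
fixed-point-free dilation that does not contain the point. -/
theorem IsDilation.trace_inter_eq_empty {π : AffinePlane P} {f : P ≃ P}
    (hf : IsDilation π f) (hfix : ∀ A, f A ≠ A) {ℓ t : Set P} (hℓ : ℓ ∈ π.lines)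
    (ht : t ∈ π.lines) (hinv : ∀ Y ∈ ℓ, f Y ∈ ℓ) {X : P} (hXℓ : X ∉ ℓ) (hX : X ∈ t)
    (hfX : f X ∈ t) : t ∩ ℓ = ∅ := by
  refine Set.eq_empty_iff_forall_notMem.2 fun Y ⟨hYt, hYℓ⟩ => hXℓ ?_
  have h : t = ℓ := (π.a1 Y (f Y) (hfix Y).symm).unique
    ⟨ht, hYt, hf.apply_mem ht hX hfX hYt⟩ ⟨hℓ, hYℓ, hinv Y hYℓ⟩
  exact h ▸ hX

/-- A dilation fixing a point and every point off a line is the identity. -/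
theorem IsDilation.eq_refl_of_fixed {π : AffinePlane P} {f : P ≃ P}
    (hf : IsDilation π f) {ℓ : Set P} (hℓ : ℓ ∈ π.lines) {A : P} (hA : A ∈ ℓ)
    (hfA : f A = A) (hfix : ∀ X, X ∉ ℓ → f X = X) : f = Equiv.refl P := by
  ext Y
  by_cases hY : Y ∈ ℓ
  swap
  · exact hfix Y hY
  obtain ⟨X, hX⟩ := π.exists_notMem hℓ
  obtain ⟨m, ⟨hm, hXm, hYm⟩, -⟩ := π.a1 X Y fun e => hX (e ▸ hY)
  have h₁ : f Y ∈ ℓ := hf.apply_mem hℓ hA (hfA.symm ▸ hA) hY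
  have h₂ : f Y ∈ m := hf.apply_mem hm hXm ((hfix X hX).symm ▸ hXm) hYm
  by_contra hne
  exact hX ((π.a1 (f Y) Y hne).unique ⟨hm, h₂, hYm⟩ ⟨hℓ, h₁, hY⟩ ▸ hXm)

/-- If a composite of two fixed-point-free dilations has a fixed point, it is the identity. -/
theorem IsDilation.trans_eq_refl {π : AffinePlane P} {f g : P ≃ P}
    (hf : IsDilation π f) (hg : IsDilation π g) (hffix : ∀ A, f A ≠ A)
    (hgfix : ∀ A, g A ≠ A) {A : P} (hA : f (g A) = A) : g.trans f = Equiv.refl P := by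
  obtain ⟨ℓ, ⟨hℓ, hAℓ, hgAℓ⟩, -⟩ := π.a1 A (g A) (hgfix A).symm
  have hfg := hg.trans hf
  refine hfg.eq_refl_of_fixed hℓ hAℓ hA fun X hX => ?_
  obtain ⟨t, ⟨ht, hXt, hgXt⟩, -⟩ := π.a1 X (g X) (hgfix X).symm
  obtain ⟨u, ⟨hu, hgXu, hfgXu⟩, -⟩ := π.a1 (g X) (f (g X)) (hffix (g X)).symm
  have htℓ : t ∩ ℓ = ∅ := hg.trace_inter_eq_empty hgfix hℓ ht
    (fun _ hY => hg.apply_mem hℓ hAℓ hgAℓ hY) hX hXt hgXt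
  have hgX : g X ∉ ℓ := fun h => Set.eq_empty_iff_forall_notMem.1 htℓ _ ⟨hgXt, h⟩
  have huℓ : u ∩ ℓ = ∅ := hf.trace_inter_eq_empty hffix hℓ hu
    (fun _ hY => hf.apply_mem hℓ hgAℓ (hA.symm ▸ hAℓ) hY) hgX hgXu hfgXu
  have hut : u = t := (π.a2 (g X) ℓ hℓ hgX).unique ⟨hu, hgXu, huℓ⟩ ⟨ht, hgXt, htℓ⟩
  obtain ⟨m, ⟨hm, hAm, hXm⟩, -⟩ := π.a1 A X fun e => hX (e ▸ hAℓ)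
  have hfgXm : f (g X) ∈ m := hfg.apply_mem hm hAm (hA.symm ▸ hAm : f (g A) ∈ m) hXm
  by_contra hne
  have hmt : m = t := (π.a1 (f (g X)) X hne).unique ⟨hm, hfgXm, hXm⟩ ⟨ht, hut ▸ hfgXu, hXt⟩
  exact Set.eq_empty_iff_forall_notMem.1 htℓ A ⟨hmt ▸ hAm, hAℓ⟩

/-- The translations of an affine plane form a subgroup of the dilation group:
the identity is a translation, composites of translations are translations, and
inverses of translations are translations. (`g.trans f` is `f ∘ g`.) -/
theorem translations_form_subgroup (π : AffinePlane P) :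
    IsTranslation π (Equiv.refl P) ∧
    (∀ f g : P ≃ P, IsTranslation π f → IsTranslation π g →
      IsTranslation π (g.trans f)) ∧
    (∀ f : P ≃ P, IsTranslation π f → IsTranslation π f.symm) := by
  refine ⟨⟨π.isDilation_refl, Or.inl rfl⟩, fun f g hf hg => ?_, fun f hf => ?_⟩
  · obtain ⟨hf, rfl | hffix⟩ := hf
    · exact hg
    obtain ⟨hg, rfl | hgfix⟩ := hg
    · exact ⟨hf, Or.inr hffix⟩
    refine ⟨hg.trans hf, or_iff_not_imp_right.2 fun h => ?_⟩
    push Not at h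
    obtain ⟨A, hA⟩ := h
    exact hf.trans_eq_refl hg hffix hgfix hA
  · refine ⟨hf.1.symm, hf.2.imp (fun h => by rw [h, Equiv.refl_symm]) fun h A hA => h A ?_⟩
    exact (f.symm_apply_eq.1 hA).symm

end AffinePlane
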